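/- The matrix P = ∫₀^∞ e^{−As} B C e^{−As} ds is invertible. -/

import Mathlib

open Matrix MeasureTheory Filter

noncomputable def mexp {p : ℕ} (M : Matrix (Fin p) (Fin p) ℝ) : Matrix (Fin p) (Fin p) ℝ :=
  ∑' k : ℕ, (k.factorial : ℝ)⁻¹ • M ^ k

def EigPos {p : ℕ} (A : Matrix (Fin p) (Fin p) ℝ) : Prop :=
  ∀ μ ∈ spectrum ℂ (A.map Complex.ofReal), 0 < μ.re

def Observable {p : ℕ} (A : Matrix (Fin p) (Fin p) ℝ) (C : Matrix (Fin 1) (Fin p) ℝ) : Prop :=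
  ∀ v : Fin p → ℝ, (∀ r : ℕ, (C * A ^ r) *ᵥ v = 0) → v = 0

def Controllable {p : ℕ} (A : Matrix (Fin p) (Fin p) ℝ) (B : Matrix (Fin p) (Fin 1) ℝ) : Prop :=
  ∀ v : Fin p → ℝ, (∀ r : ℕ, (Bᵀ * Aᵀ ^ r) *ᵥ v = 0) → v = 0

noncomputable def Qmat {p : ℕ} (A : Matrix (Fin p) (Fin p) ℝ) (C : Matrix (Fin 1) (Fin p) ℝ) :
    Matrix (Fin p) (Fin p) ℝ :=
  Matrix.of fun i j =>
    ∫ s in Set.Ioi (0 : ℝ), (mexp (-(s • Aᵀ)) * (Cᵀ * C) * mexp (-(s • A))) i j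

noncomputable def Nmat {p : ℕ} (A : Matrix (Fin p) (Fin p) ℝ) (B : Matrix (Fin p) (Fin 1) ℝ) :
    Matrix (Fin p) (Fin p) ℝ :=
  Matrix.of fun i j =>
    ∫ s in Set.Ioi (0 : ℝ), (mexp (-(s • A)) * (B * Bᵀ) * mexp (-(s • Aᵀ))) i j

noncomputable def Pmat {p : ℕ} (A : Matrix (Fin p) (Fin p) ℝ) (B : Matrix (Fin p) (Fin 1) ℝ)
    (C : Matrix (Fin 1) (Fin p) ℝ) : Matrix (Fin p) (Fin p) ℝ :=
  Matrix.of fun i j =>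
    ∫ s in Set.Ioi (0 : ℝ), (mexp (-(s • A)) * (B * C) * mexp (-(s • A))) i j

noncomputable def Fmat {p : ℕ} (A : Matrix (Fin p) (Fin p) ℝ) (B : Matrix (Fin p) (Fin 1) ℝ)
    (C : Matrix (Fin 1) (Fin p) ℝ) (x t : ℝ) : Matrix (Fin p) (Fin p) ℝ :=
  mexp ((2 * x) • Aᵀ - (8 * t) • Aᵀ ^ 3) +
    Qmat A C * mexp (-((2 * x) • A) + (8 * t) • A ^ 3) * Nmat A B

noncomputable def Emat {p : ℕ} (A : Matrix (Fin p) (Fin p) ℝ) (B : Matrix (Fin p) (Fin 1) ℝ)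
    (C : Matrix (Fin 1) (Fin p) ℝ) (x t : ℝ) : Matrix (Fin p) (Fin p) ℝ :=
  mexp ((2 * x) • A - (8 * t) • A ^ 3) +
    Pmat A B C * mexp (-((2 * x) • A) + (8 * t) • A ^ 3) * Pmat A B C

noncomputable def uFun {p : ℕ} (A : Matrix (Fin p) (Fin p) ℝ) (B : Matrix (Fin p) (Fin 1) ℝ)
    (C : Matrix (Fin 1) (Fin p) ℝ) (x t : ℝ) : ℝ :=
  -2 * ((Bᵀ * (Fmat A B C x t)⁻¹ * Cᵀ : Matrix (Fin 1) (Fin 1) ℝ) 0 0)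

noncomputable def vFun {p : ℕ} (A : Matrix (Fin p) (Fin p) ℝ) (B : Matrix (Fin p) (Fin 1) ℝ)
    (C : Matrix (Fin 1) (Fin p) ℝ) (x t : ℝ) : ℝ :=
  -2 * ((C * (Emat A B C x t)⁻¹ * B : Matrix (Fin 1) (Fin 1) ℝ) 0 0)

noncomputable def calQ {p : ℕ} (A : Matrix (Fin p) (Fin p) ℝ) (C : Matrix (Fin 1) (Fin p) ℝ)
    (x t : ℝ) : Matrix (Fin p) (Fin p) ℝ :=
  mexp (-(x • Aᵀ)) * mexp ((8 * t) • Aᵀ ^ 3) * Qmat A C * mexp (-(x • A)) * mexp ((8 * t) • A ^ 3)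

noncomputable def calN {p : ℕ} (A : Matrix (Fin p) (Fin p) ℝ) (B : Matrix (Fin p) (Fin 1) ℝ)
    (x : ℝ) : Matrix (Fin p) (Fin p) ℝ :=
  mexp (-(x • A)) * Nmat A B * mexp (-(x • Aᵀ))

noncomputable def Gam {p : ℕ} (A : Matrix (Fin p) (Fin p) ℝ) (B : Matrix (Fin p) (Fin 1) ℝ)
    (C : Matrix (Fin 1) (Fin p) ℝ) (x t : ℝ) : Matrix (Fin p) (Fin p) ℝ :=
  1 + calQ A C x t * calN A B x

noncomputable def Om {p : ℕ} (A : Matrix (Fin p) (Fin p) ℝ) (B : Matrix (Fin p) (Fin 1) ℝ)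
    (C : Matrix (Fin 1) (Fin p) ℝ) (w t : ℝ) : ℝ :=
  ((C * mexp (-(w • A)) * mexp ((8 * t) • A ^ 3) * B : Matrix (Fin 1) (Fin 1) ℝ) 0 0)

noncomputable def Kker {p : ℕ} (A : Matrix (Fin p) (Fin p) ℝ) (B : Matrix (Fin p) (Fin 1) ℝ)
    (C : Matrix (Fin 1) (Fin p) ℝ) (x y t : ℝ) : ℝ :=
  ((Bᵀ * (Fmat A B C x t)⁻¹ * mexp (-((y - x) • Aᵀ)) * Cᵀ : Matrix (Fin 1) (Fin 1) ℝ) 0 0)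

def DecE {E : Type*} [NormedAddCommGroup E] (f : ℝ → E) : Prop :=
  ∃ c : ℝ, 0 < c ∧ f =O[atTop] (fun s : ℝ => Real.exp (-c * s))

lemma isBigO_exp_mono {c d : ℝ} (h : c ≤ d) :
    (fun s : ℝ => Real.exp (-d * s)) =O[atTop] (fun s : ℝ => Real.exp (-c * s)) := by
  apply Asymptotics.IsBigO.of_bound 1
  filter_upwards [eventually_ge_atTop 0] with s hs
  simp only [Real.norm_eq_abs, Real.abs_exp, one_mul]
  apply Real.exp_le_exp.2
  nlinarith

lemma DecE.zero {E : Type*} [NormedAddCommGroup E] : DecE (fun _ : ℝ => (0 : E)) :=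
  ⟨1, one_pos, Asymptotics.isBigO_zero _ _⟩

lemma DecE.add {E : Type*} [NormedAddCommGroup E] {f g : ℝ → E} (hf : DecE f) (hg : DecE g) :
    DecE (fun s => f s + g s) := by
  obtain ⟨c, hc, hf⟩ := hf
  obtain ⟨d, hd, hg⟩ := hg
  exact ⟨min c d, lt_min hc hd, (hf.trans (isBigO_exp_mono (min_le_left _ _))).add
    (hg.trans (isBigO_exp_mono (min_le_right _ _)))⟩

lemma DecE.sum {ι E : Type*} [NormedAddCommGroup E] (t : Finset ι) {f : ι → ℝ → E}
    (hf : ∀ i ∈ t, DecE (f i)) : DecE (fun s => ∑ i ∈ t, f i s) := by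
  classical
  induction t using Finset.induction_on with
  | empty => simpa using DecE.zero
  | insert a t ha ih =>
    simp only [Finset.sum_insert ha]
    exact (hf a (by simp)).add (ih fun i hi => hf i (by simp [hi]))

lemma DecE.of_le {E F : Type*} [NormedAddCommGroup E] [NormedAddCommGroup F] {f : ℝ → E}
    {g : ℝ → F} (hf : DecE f) (K : ℝ) (h : ∀ s, ‖g s‖ ≤ K * ‖f s‖) : DecE g := by
  obtain ⟨c, hc, hf⟩ := hf
  exact ⟨c, hc, (Asymptotics.IsBigO.of_bound K (Eventually.of_forall h)).trans hf⟩

lemma DecE.mul {f g : ℝ → ℝ} (hf : DecE f) (hg : DecE g) : DecE (fun s => f s * g s) := by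
  obtain ⟨c, hc, hf⟩ := hf
  obtain ⟨d, hd, hg⟩ := hg
  refine ⟨c + d, by positivity, (hf.mul hg).congr_right fun s => ?_⟩
  rw [← Real.exp_add]; ring_nf

lemma DecE.tendsto {f : ℝ → ℝ} (hf : DecE f) : Tendsto f atTop (nhds 0) := by
  obtain ⟨c, hc, hf⟩ := hf
  refine hf.trans_tendsto ?_
  have : Tendsto (fun s : ℝ => c * s) atTop atTop := tendsto_id.const_mul_atTop hc
  simpa [Function.comp_def] using Real.tendsto_exp_neg_atTop_nhds_zero.comp this

lemma DecE_pow_exp (j : ℕ) {μ : ℂ} (h : 0 < μ.re) :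
    DecE (fun s : ℝ => ((s : ℂ) ^ j * Complex.exp (-((s : ℂ) * μ)))) := by
  refine ⟨μ.re / 2, by positivity, ?_⟩
  have h1 : (fun s : ℝ => s ^ j) =O[atTop] (fun s : ℝ => Real.exp (μ.re / 2 * s)) :=
    (isLittleO_pow_exp_pos_mul_atTop j (by positivity)).isBigO
  have h2 := h1.mul (Asymptotics.isBigO_refl (fun s : ℝ => Real.exp (-(s * μ.re))) atTop)
  refine ((h2.norm_left).congr_left fun s => ?_).congr_right (fun s => ?_) |>.of_norm_left
  · simp [Complex.norm_exp]
  · rw [← Real.exp_add]; ring_nf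

section
attribute [local instance] Matrix.linftyOpNormedRing Matrix.linftyOpNormedAlgebra

lemma mexp_eq {p : ℕ} (M : Matrix (Fin p) (Fin p) ℝ) : mexp M = NormedSpace.exp M := by
  rw [mexp, NormedSpace.exp_eq_tsum ℝ]

lemma exp_map {p : ℕ} (M : Matrix (Fin p) (Fin p) ℝ) :
    (NormedSpace.exp M).map Complex.ofReal = NormedSpace.exp (M.map Complex.ofReal) := by
  have := NormedSpace.map_exp (Complex.ofRealHom.mapMatrix (m := Fin p))
    (continuous_id.matrix_map Complex.continuous_ofReal) M
  exact this

lemma exp_mulVec_nil {p : ℕ} (N : Matrix (Fin p) (Fin p) ℂ) (v : Fin p → ℂ) (k : ℕ)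
    (h : (N ^ k) *ᵥ v = 0) (s : ℂ) :
    NormedSpace.exp (s • N) *ᵥ v =
      ∑ j ∈ Finset.range k, ((j.factorial : ℂ)⁻¹ * s ^ j) • (N ^ j *ᵥ v) := by
  have h1 : HasSum (fun j : ℕ => (j.factorial : ℂ)⁻¹ • (s • N) ^ j) (NormedSpace.exp (s • N)) :=
    NormedSpace.exp_series_hasSum_exp' (s • N)
  let L : Matrix (Fin p) (Fin p) ℂ →+ (Fin p → ℂ) :=
    { toFun := fun M => M *ᵥ v, map_zero' := by simp, map_add' := fun a b => add_mulVec a b v }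
  have hL : Continuous L := continuous_id.matrix_mulVec continuous_const
  have h2 := h1.map L hL
  refine h2.unique ?_
  have h3 : (L ∘ fun j : ℕ => (j.factorial : ℂ)⁻¹ • (s • N) ^ j) =
      fun j => ((j.factorial : ℂ)⁻¹ * s ^ j) • (N ^ j *ᵥ v) := by
    funext j
    simp [L, smul_pow, smul_mulVec, smul_smul]
  rw [h3]
  apply hasSum_sum_of_ne_finset_zero
  intro j hj
  obtain ⟨m, rfl⟩ := Nat.exists_eq_add_of_le (not_lt.1 (by simpa using hj) : k ≤ j)
  rw [add_comm k m, pow_add N, ← mulVec_mulVec, h]; simp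

lemma exp_shift {p : ℕ} (A : Matrix (Fin p) (Fin p) ℂ) (μ s : ℂ) :
    NormedSpace.exp (-(s • A)) =
      Complex.exp (-(s * μ)) • NormedSpace.exp ((-s) • (A - algebraMap ℂ _ μ)) := by
  have h : -(s • A) = algebraMap ℂ (Matrix (Fin p) (Fin p) ℂ) (-(s * μ))
      + (-s) • (A - algebraMap ℂ _ μ) := by
    simp only [Algebra.algebraMap_eq_smul_one, smul_sub, smul_smul, neg_smul, neg_mul]
    abel
  rw [h, Matrix.exp_add_of_commute _ _ (Algebra.commute_algebraMap_left _ _), Complex.exp_eq_exp_ℂ,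
    Algebra.smul_def (NormedSpace.exp (-(s * μ)))]
  congr 1
  exact (NormedSpace.algebraMap_exp_comm (𝕂 := ℂ) (𝔸 := Matrix (Fin p) (Fin p) ℂ) _).symm

lemma decay_vec {p : ℕ} (A : Matrix (Fin p) (Fin p) ℂ)
    (hA : ∀ μ ∈ spectrum ℂ A, 0 < μ.re) (v : Fin p → ℂ) :
    DecE (fun s : ℝ => NormedSpace.exp (-((s : ℂ) • A)) *ᵥ v) := by
  let S : Submodule ℂ (Fin p → ℂ) :=
    { carrier := {v | DecE (fun s : ℝ => NormedSpace.exp (-((s : ℂ) • A)) *ᵥ v)}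
      zero_mem' := by simpa using DecE.zero
      add_mem' := by
        intro a b ha hb
        simpa [mulVec_add] using DecE.add ha hb
      smul_mem' := by
        intro c a ha
        refine DecE.of_le ha ‖c‖ fun s => ?_
        rw [mulVec_smul, norm_smul] }
  suffices h : S = ⊤ by
    have : v ∈ S := h ▸ Submodule.mem_top
    exact this
  rw [eq_top_iff, ← Module.End.iSup_maxGenEigenspace_eq_top (Matrix.toLin' A)]
  refine iSup_le fun μ => ?_
  intro v hv
  by_cases hv0 : v = 0
  · rw [hv0]; exact S.zero_mem
  obtain ⟨k, hk⟩ := (Module.End.mem_maxGenEigenspace _ _ _).1 hv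
  have hμ : μ ∈ spectrum ℂ A := by
    rw [← Matrix.spectrum_toLin', ← Module.End.hasEigenvalue_iff_mem_spectrum]
    refine Module.End.hasEigenvalue_of_hasGenEigenvalue (k := k) ?_
    change Module.End.genEigenspace _ _ _ ≠ ⊥
    rw [Submodule.ne_bot_iff]
    exact ⟨v, (Module.End.mem_genEigenspace_nat).2 (by simpa using hk), hv0⟩
  have hre := hA μ hμ
  set N := A - algebraMap ℂ (Matrix (Fin p) (Fin p) ℂ) μ with hN
  have hkN : (N ^ k) *ᵥ v = 0 := by
    have : Matrix.toLin' (N ^ k) = (Matrix.toLin' A - μ • (1 : Module.End ℂ (Fin p → ℂ))) ^ k := by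
      rw [Matrix.toLin'_pow, hN, map_sub, Algebra.algebraMap_eq_smul_one, map_smul,
        Matrix.toLin'_one]
      rfl
    rw [← Matrix.toLin'_apply, this]; exact hk
  change DecE _
  have : (fun s : ℝ => NormedSpace.exp (-((s : ℂ) • A)) *ᵥ v) = fun s : ℝ =>
      ∑ j ∈ Finset.range k, ((s : ℂ) ^ j * Complex.exp (-((s : ℂ) * μ))) •
        (((j.factorial : ℂ)⁻¹ * (-1) ^ j) • (N ^ j *ᵥ v)) := by
    funext s
    rw [exp_shift A μ, smul_mulVec, exp_mulVec_nil N v k hkN, Finset.smul_sum]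
    refine Finset.sum_congr rfl fun j _ => ?_
    rw [smul_smul, smul_smul]
    congr 1
    rw [neg_pow]; ring
  rw [this]
  refine DecE.sum _ fun j _ => ?_
  refine DecE.of_le (DecE_pow_exp j hre) ‖(((j.factorial : ℂ)⁻¹ * (-1) ^ j) • (N ^ j *ᵥ v))‖
    fun s => ?_
  rw [norm_smul, mul_comm]

lemma decay_entry {p : ℕ} (A : Matrix (Fin p) (Fin p) ℝ) (hA : EigPos A) (i j : Fin p) :
    DecE (fun s : ℝ => mexp (-(s • A)) i j) := by
  refine DecE.of_le (decay_vec (A.map Complex.ofReal) hA (Pi.single j 1)) 1 fun s => ?_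
  have h : -((s : ℂ) • A.map Complex.ofReal) = (-(s • A)).map Complex.ofReal := by
    ext a b; simp
  rw [one_mul, h, ← exp_map, ← mexp_eq]
  refine le_trans ?_ (norm_le_pi_norm _ i)
  simp

lemma hasDerivAt_mexp {p : ℕ} (A : Matrix (Fin p) (Fin p) ℝ) (s : ℝ) :
    HasDerivAt (fun s : ℝ => mexp (-(s • A))) (-(A * mexp (-(s • A)))) s ∧
    HasDerivAt (fun s : ℝ => mexp (-(s • A))) (-(mexp (-(s • A)) * A)) s := by
  have h1 := hasDerivAt_exp_smul_const (𝕂 := ℝ) (-A) s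
  have h2 := hasDerivAt_exp_smul_const' (𝕂 := ℝ) (-A) s
  simp only [smul_neg, mul_neg, neg_mul] at h1 h2
  simp only [mexp_eq]
  exact ⟨h2, h1⟩

lemma sylvester {p : ℕ} (A : Matrix (Fin p) (Fin p) ℝ)
    (B : Matrix (Fin p) (Fin 1) ℝ) (C : Matrix (Fin 1) (Fin p) ℝ) (hA : EigPos A) :
    A * Pmat A B C + Pmat A B C * A = B * C := by
  set F : ℝ → Matrix (Fin p) (Fin p) ℝ :=
    fun s => mexp (-(s • A)) * (B * C) * mexp (-(s • A)) with hF
  have hder : ∀ s, HasDerivAt F (-(A * F s + F s * A)) s := by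
    intro s
    obtain ⟨h1, h2⟩ := hasDerivAt_mexp A s
    have := (h1.mul_const (B * C)).mul h2
    have e : -(A * F s + F s * A) = -(A * mexp (-(s • A))) * (B * C) * mexp (-(s • A)) +
        mexp (-(s • A)) * (B * C) * -(mexp (-(s • A)) * A) := by
      simp only [hF, Matrix.neg_mul, Matrix.mul_neg, Matrix.mul_assoc, neg_add]
    rw [e]
    exact this
  have hderE : ∀ i j s, HasDerivAt (fun s => F s i j) ((-(A * F s + F s * A)) i j) s := by
    intro i j s
    exact hasDerivAt_pi.1 (hasDerivAt_pi.1 (hder s) i) j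
  have hdec : ∀ i j, DecE (fun s => F s i j) := by
    intro i j
    have e : (fun s => F s i j) = fun s => ∑ l, (∑ k, mexp (-(s • A)) i k * (B * C) k l) *
        mexp (-(s • A)) l j := rfl
    rw [e]
    refine DecE.sum _ fun l _ => DecE.mul (DecE.sum _ fun k _ => ?_) (decay_entry A hA l j)
    refine DecE.of_le (decay_entry A hA i k) ‖(B * C) k l‖ fun s => ?_
    rw [norm_mul, mul_comm]
  have hint : ∀ i j, IntegrableOn (fun s => F s i j) (Set.Ioi 0) := by
    intro i j
    obtain ⟨c, hc, h⟩ := hdec i j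
    exact integrable_of_isBigO_exp_neg hc
      (fun s _ => (hderE i j s).continuousAt.continuousWithinAt) h
  have hI : ∀ i j, ∫ s in Set.Ioi (0:ℝ), (A * F s + F s * A) i j =
      (A * Pmat A B C + Pmat A B C * A) i j := by
    intro i j
    have e : Pmat A B C = Matrix.of fun i j => ∫ s in Set.Ioi (0:ℝ), F s i j := rfl
    simp only [e, Matrix.add_apply, Matrix.mul_apply, Matrix.of_apply]
    rw [integral_add, integral_finsetSum, integral_finsetSum]
    · simp only [integral_const_mul, integral_mul_const]
    · exact fun k _ => (hint i k).mul_const _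
    · exact fun k _ => (hint k j).const_mul _
    · exact integrable_finsetSum _ fun k _ => (hint k j).const_mul _
    · exact integrable_finsetSum _ fun k _ => (hint i k).mul_const _
  ext i j
  have hi2 : IntegrableOn (fun s => (-(A * F s + F s * A)) i j) (Set.Ioi 0) := by
    simp only [Matrix.neg_apply, Matrix.add_apply, Matrix.mul_apply]
    exact ((integrable_finsetSum _ fun k _ => (hint k j).const_mul _).add
      (integrable_finsetSum _ fun k _ => (hint i k).mul_const _)).neg
  have := integral_Ioi_of_hasDerivAt_of_tendsto' (fun s _ => hderE i j s) hi2 (hdec i j).tendsto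
  simp only [Matrix.neg_apply, integral_neg, hI] at this
  have h0 : F 0 = B * C := by simp [hF, mexp_eq]
  rw [h0] at this
  linarith

end

theorem statement9 {p : ℕ} (hp : 0 < p) (A : Matrix (Fin p) (Fin p) ℝ)
    (B : Matrix (Fin p) (Fin 1) ℝ) (C : Matrix (Fin 1) (Fin p) ℝ)
    (hA : EigPos A) (hobs : Observable A C) (hctrl : Controllable A B) :
    IsUnit (Pmat A B C) := by
  have hS := sylvester A B C hA
  set P := Pmat A B C
  have hS' : ∀ v, A *ᵥ (P *ᵥ v) + P *ᵥ (A *ᵥ v) = B *ᵥ (C *ᵥ v) := by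
    intro v
    simp only [mulVec_mulVec, ← add_mulVec, hS]
  by_cases h : ∀ x, P *ᵥ x = 0 → C *ᵥ x = 0
  · rw [← Matrix.mulVec_injective_iff_isUnit]
    have hker : ∀ x, P *ᵥ x = 0 → x = 0 := by
      intro x hx
      have hinv : ∀ r : ℕ, P *ᵥ (A ^ r *ᵥ x) = 0 := by
        intro r
        induction r with
        | zero => simpa using hx
        | succ r ih =>
          have := hS' (A ^ r *ᵥ x)
          rw [ih, h _ ih] at this
          simpa [pow_succ', mulVec_mulVec] using this
      exact hobs x fun r => by rw [← mulVec_mulVec]; exact h _ (hinv r)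
    intro x y hxy
    exact sub_eq_zero.1 (hker _ (by rw [mulVec_sub]; exact sub_eq_zero.2 hxy))
  · push Not at h
    obtain ⟨x, hx, hCx⟩ := h
    rw [← Matrix.vecMul_injective_iff_isUnit]
    have hc : (C *ᵥ x) 0 ≠ 0 := fun h0 => hCx (by
      funext i; rw [Subsingleton.elim i 0]; exact h0)
    have hker : ∀ y, y ᵥ* P = 0 → y ᵥ* B = 0 := by
      intro y hy
      have h1 := congrArg (fun w => y ⬝ᵥ w) (hS' x)
      simp only [hx, mulVec_zero, zero_add] at h1
      rw [dotProduct_mulVec, hy, zero_dotProduct, dotProduct_mulVec] at h1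
      funext i
      rw [Subsingleton.elim i 0]
      simp only [dotProduct, Finset.univ_unique, Fin.default_eq_zero, Finset.sum_singleton] at h1
      simpa [hc] using h1.symm
    have hker2 : ∀ y, y ᵥ* P = 0 → y = 0 := by
      intro y hy
      have hinv : ∀ r : ℕ, (y ᵥ* A ^ r) ᵥ* P = 0 := by
        intro r
        induction r with
        | zero => simpa using hy
        | succ r ih =>
          have := congrArg (fun M => (y ᵥ* A ^ r) ᵥ* M) hS
          simp only [vecMul_add, ← vecMul_vecMul (y ᵥ* A ^ r), ih, hker _ ih, zero_vecMul, add_zero]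
            at this
          rw [pow_succ, ← vecMul_vecMul]; exact this
      refine hctrl y fun r => ?_
      rw [← Matrix.transpose_pow, ← Matrix.transpose_mul, mulVec_transpose, ← vecMul_vecMul]
      exact hker _ (hinv r)
    intro y z hyz
    exact sub_eq_zero.1 (hker2 _ (by rw [sub_vecMul]; exact sub_eq_zero.2 hyz))
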